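/- (Lemma 2.8) Let R be a commutative ring, X a topological space, and 𝒜 a collection of subsets of X whose union is W ⊆ X. Suppose W = ⋃_{U ∈ 𝒜} Int_W(U), where Int_W(U) denotes the interior of U in the subspace topology of W. Then there exists a pre-chain map (ℏ_k)_{k ≥ 0} on X with coefficients in R such that: (i) for every k and every singular k-simplex σ of X with range(σ) ⊆ W, every singular k-simplex η of Δ^k in the support of ℏ_k(σ) satisfies range(σ ∘ η) ⊆ U for some U ∈ 𝒜 (so σ_#(ℏ_k(σ)) is a chain of simplices each lying in some element of 𝒜); and (ii) ℏ_k(σ) is the single simplex id_{Δ^k} (with coefficient 1) whenever range(σ) ⊆ U for some U ∈ 𝒜. -/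

import Mathlib

open Set

attribute [local instance] Classical.propDecidable

noncomputable section

/-- The standard `k`-simplex, as a topological space. -/
abbrev Δ (k : ℕ) : Type := ↥(stdSimplex ℝ (Fin (k+1)))

/-- A singular `k`-simplex in `Y`: a continuous map from the standard `k`-simplex. -/
abbrev SSimplex (Y : Type*) [TopologicalSpace Y] (k : ℕ) : Type _ := C(Δ k, Y)

/-- `S_p(Y;R)`: finite singular `p`-chains, i.e. finitely supported functions from
the singular `p`-simplices of `Y` to `R`. -/
abbrev FChain (Y : Type*) [TopologicalSpace Y] (R : Type*) [CommRing R] (p : ℕ) : Type _ :=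
  SSimplex Y p →₀ R

/-- The affine map between standard simplices extending `e i ↦ e (m i)` on vertices. -/
def affMap {a b : ℕ} (m : Fin a → Fin b) :
    C(↥(stdSimplex ℝ (Fin a)), ↥(stdSimplex ℝ (Fin b))) where
  toFun t :=
    ⟨fun j => ∑ i, if m i = j then t.1 i else 0, by
      constructor
      · intro j
        refine Finset.sum_nonneg fun i _ => ?_
        by_cases h : m i = j
        · simpa [h] using t.2.1 i
        · simp [h]
      · rw [Finset.sum_comm]
        have h1 : ∀ i : Fin a, (∑ j, if m i = j then t.1 i else 0) = t.1 i := by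
          intro i
          simp [Finset.sum_ite_eq]
        calc (∑ i, ∑ j, if m i = j then t.1 i else 0) = ∑ i, t.1 i :=
              Finset.sum_congr rfl fun i _ => h1 i
          _ = 1 := t.2.2⟩
  continuous_toFun := by
    apply Continuous.subtype_mk
    apply continuous_pi
    intro j
    apply continuous_finset_sum
    intro i _
    by_cases h : m i = j
    · simp only [h, if_true]
      exact (continuous_apply i).comp continuous_subtype_val
    · simp only [h, if_false]
      exact continuous_const

/-- The `p`-th face inclusion `ι_{k+1;p} : Δ^k → Δ^{k+1}`, sending the vertices
`e_0, …, e_k` in order to the vertices `e_0, …, e_{p-1}, e_{p+1}, …, e_{k+1}`. -/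
def face (k : ℕ) (p : Fin (k+2)) : C(Δ k, Δ (k+1)) := affMap (Fin.succAbove p)

/-- The pushforward `g_# : S_p(Y;R) → S_p(Y';R)`, the linear extension of `σ ↦ g ∘ σ`. -/
def fpush {Y Y' : Type*} [TopologicalSpace Y] [TopologicalSpace Y'] {R : Type*} [CommRing R]
    {p : ℕ} (g : C(Y, Y')) (c : FChain Y R p) : FChain Y' R p :=
  Finsupp.mapDomain (fun σ : SSimplex Y p => g.comp σ) c

/-- The boundary operator `∂ : S_{k+1}(Y;R) → S_k(Y;R)`, the linear extension of
`σ ↦ ∑_p (-1)^p (σ ∘ ι_{k+1;p})`. -/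
def fboundary {Y : Type*} [TopologicalSpace Y] {R : Type*} [CommRing R] (k : ℕ)
    (c : FChain Y R (k+1)) : FChain Y R k :=
  c.sum fun σ a =>
    ∑ p : Fin (k+2), Finsupp.single (σ.comp (face k p)) ((-1 : R)^(p : ℕ) * a)

/-- A pre-chain map on `X` with coefficients in `R`: a family of maps
`ℏ_k : Hom(Δ^k,X) → S_k(Δ^k;R)` satisfying the compatibility
`∂(ℏ_{k+1}(σ)) = ∑_p (-1)^p (ι_{k+1;p})_#(ℏ_k(σ ∘ ι_{k+1;p}))`. -/
def IsPreChainMap {X : Type*} [TopologicalSpace X] {R : Type*} [CommRing R]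
    (hb : ∀ k : ℕ, SSimplex X k → FChain (Δ k) R k) : Prop :=
  ∀ (k : ℕ) (σ : SSimplex X (k+1)),
    fboundary k (hb (k+1) σ) =
      ∑ p : Fin (k+2), (-1 : R)^(p : ℕ) • fpush (face k p) (hb k (σ.comp (face k p)))

/-- Chains on ordered tuples of `m` points of `S`; tuples of length `0` provide the augmentation. -/
abbrev TupleChain (S R : Type*) [CommRing R] (m : ℕ) : Type _ := (Fin m → S) →₀ R

namespace TupleChain

open Finsupp

variable {S S' R : Type*} [CommRing R]

theorem map_mem_supported {α β : Type*} {A : Set α} {B : Set β} (f : (α →₀ R) →ₗ[R] (β →₀ R))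
    (hf : ∀ a ∈ A, f (single a 1) ∈ supported R R B) {c : α →₀ R} (hc : c ∈ supported R R A) :
    f c ∈ supported R R B := by
  rw [supported_eq_span_single] at hc
  induction hc using Submodule.span_induction with
  | mem x hx => obtain ⟨a, ha, rfl⟩ := hx; exact hf a ha
  | zero => simp
  | add x y _ _ hx hy => rw [map_add]; exact add_mem hx hy
  | smul a x _ hx => rw [map_smul]; exact Submodule.smul_mem _ _ hx

variable (R) in
/-- The tuple chain consisting of a single tuple. -/
abbrev of {m : ℕ} (v : Fin m → S) : TupleChain S R m := single v 1

/-- The alternating sum of the faces of a tuple. -/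
def boundary (m : ℕ) : TupleChain S R (m + 1) →ₗ[R] TupleChain S R m :=
  linearCombination R fun v => ∑ p : Fin (m + 1), (-1 : R) ^ (p : ℕ) • of R (v ∘ p.succAbove)

/-- Pushforward of tuple chains along a map of point sets. -/
def push (g : S → S') (m : ℕ) : TupleChain S R m →ₗ[R] TupleChain S' R m :=
  lmapDomain R R (g ∘ ·)

/-- Prepending a fixed point to every tuple. -/
def cone (b : S) (m : ℕ) : TupleChain S R m →ₗ[R] TupleChain S R (m + 1) :=
  lmapDomain R R fun v => (Fin.cons b v : Fin (m + 1) → S)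

theorem boundary_of {m : ℕ} (v : Fin (m + 1) → S) :
    boundary m (of R v) = ∑ p : Fin (m + 1), (-1 : R) ^ (p : ℕ) • of R (v ∘ p.succAbove) := by
  simp [boundary]

theorem push_of (g : S → S') {m : ℕ} (v : Fin m → S) : push g m (of R v) = of R (g ∘ v) := by
  simp [push, mapDomain_single]

theorem cone_of (b : S) {m : ℕ} (v : Fin m → S) :
    cone b m (of R v) = of R (Fin.cons b v : Fin (m + 1) → S) := by
  simp [cone, mapDomain_single]

theorem push_push {S'' : Type*} (g : S' → S'') (f : S → S') {m : ℕ} (c : TupleChain S R m) :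
    push g m (push f m c) = push (g ∘ f) m c := by
  simp only [push, lmapDomain_apply, ← mapDomain_comp]
  rfl

theorem boundary_push (g : S → S') (m : ℕ) (c : TupleChain S R (m + 1)) :
    boundary m (push g (m + 1) c) = push g m (boundary m c) := by
  suffices boundary m ∘ₗ push g (m + 1) = push g m ∘ₗ (boundary m : TupleChain S R (m + 1) →ₗ[R] _)
    from LinearMap.congr_fun this c
  ext v : 2
  simp only [LinearMap.comp_apply, lsingle_apply, push_of, boundary_of, map_sum, map_smul]
  rfl

/-- The cycles of the augmented complex of tuple chains. -/
def IsCycle : ∀ {m : ℕ}, TupleChain S R m → Prop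
  | 0, _ => True
  | m + 1, c => boundary m c = 0

theorem boundary_cone_zero (b : S) (c : TupleChain S R 0) : boundary 0 (cone b 0 c) = c := by
  suffices boundary 0 ∘ₗ cone b 0 = (LinearMap.id : TupleChain S R 0 →ₗ[R] _) from
    LinearMap.congr_fun this c
  ext v : 2
  simp only [LinearMap.comp_apply, lsingle_apply, cone_of, boundary_of, LinearMap.id_apply]
  simp [Subsingleton.elim _ v]

theorem boundary_cone_succ (b : S) (m : ℕ) (c : TupleChain S R (m + 1)) :
    boundary (m + 1) (cone b (m + 1) c) = c - cone b m (boundary m c) := by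
  suffices boundary (m + 1) ∘ₗ cone b (m + 1) =
      LinearMap.id - cone b m ∘ₗ (boundary m : TupleChain S R (m + 1) →ₗ[R] _) from
    LinearMap.congr_fun this c
  ext v : 2
  simp only [LinearMap.comp_apply, lsingle_apply, cone_of, boundary_of, LinearMap.id_apply,
    LinearMap.sub_apply, map_sum, map_smul]
  rw [Fin.sum_univ_succ, sub_eq_add_neg, ← Finset.sum_neg_distrib]
  congr 1
  · have : (Fin.cons b v : Fin (m + 2) → S) ∘ Fin.succAbove 0 = v := by ext i; simp
    rw [this]; simp
  · refine Finset.sum_congr rfl fun p _ => ?_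
    have : (Fin.cons b v : Fin (m + 2) → S) ∘ p.succ.succAbove =
        (Fin.cons b (v ∘ p.succAbove) : Fin (m + 1) → S) := by
      ext i
      refine Fin.cases ?_ (fun i => ?_) i <;> simp
    rw [this, Fin.val_succ, pow_succ, mul_neg_one, neg_smul]

theorem boundary_cone (b : S) {m : ℕ} {c : TupleChain S R m} (hc : IsCycle c) :
    boundary m (cone b m c) = c := by
  cases m with
  | zero => exact boundary_cone_zero b c
  | succ m => rw [boundary_cone_succ, show boundary m c = 0 from hc, map_zero, sub_zero]

theorem of_eq_cone {m : ℕ} (v : Fin (m + 1) → S) : of R v = cone (v 0) m (of R (Fin.tail v)) := by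
  rw [cone_of, Fin.cons_self_tail]

theorem boundary_boundary (m : ℕ) (c : TupleChain S R (m + 2)) :
    boundary m (boundary (m + 1) c) = 0 := by
  induction m with
  | zero =>
    suffices boundary 0 ∘ₗ (boundary 1 : TupleChain S R 2 →ₗ[R] _) = 0 from
      LinearMap.congr_fun this c
    ext v : 2
    change boundary _ (boundary _ (of R v)) = 0
    rw [of_eq_cone, boundary_cone_succ, map_sub, boundary_cone_zero, sub_self]
  | succ m ih =>
    suffices boundary (m + 1) ∘ₗ (boundary (m + 2) : TupleChain S R (m + 3) →ₗ[R] _) = 0 from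
      LinearMap.congr_fun this c
    ext v : 2
    change boundary _ (boundary _ (of R v)) = 0
    rw [of_eq_cone, boundary_cone_succ, map_sub, boundary_cone_succ, ih, map_zero,
      sub_zero, sub_self]

/-- Subdivision of tuple chains with respect to a choice of centre for every tuple. -/
def subdivision (b : ∀ m, (Fin (m + 1) → S) → S) : ∀ m, TupleChain S R m →ₗ[R] TupleChain S R m
  | 0 => LinearMap.id
  | m + 1 => linearCombination R fun v => cone (b m v) m (subdivision b m (boundary m (of R v)))

/-- The chain homotopy between the identity and the subdivision operator. -/
def homotopy (b : ∀ m, (Fin (m + 1) → S) → S) :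
    ∀ m, TupleChain S R m →ₗ[R] TupleChain S R (m + 1)
  | 0 => 0
  | m + 1 => linearCombination R fun v =>
      cone (b m v) (m + 1) (of R v - homotopy b m (boundary m (of R v)))

variable (b : ∀ m, (Fin (m + 1) → S) → S)

theorem subdivision_of {m : ℕ} (v : Fin (m + 1) → S) :
    subdivision b (m + 1) (of R v) = cone (b m v) m (subdivision b m (boundary m (of R v))) := by
  simp [subdivision]

theorem homotopy_of {m : ℕ} (v : Fin (m + 1) → S) :
    homotopy b (m + 1) (of R v) =
      cone (b m v) (m + 1) (of R v - homotopy b m (boundary m (of R v))) := by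
  simp [homotopy]

theorem boundary_subdivision (m : ℕ) (c : TupleChain S R (m + 1)) :
    boundary m (subdivision b (m + 1) c) = subdivision b m (boundary m c) := by
  induction m with
  | zero =>
    suffices boundary 0 ∘ₗ subdivision b 1 =
        subdivision b 0 ∘ₗ (boundary 0 : TupleChain S R 1 →ₗ[R] _) from LinearMap.congr_fun this c
    ext v : 2
    simp only [LinearMap.comp_apply, lsingle_apply, subdivision_of, boundary_cone_zero]
  | succ m ih =>
    suffices boundary (m + 1) ∘ₗ subdivision b (m + 2) =
        subdivision b (m + 1) ∘ₗ (boundary (m + 1) : TupleChain S R (m + 2) →ₗ[R] _) from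
      LinearMap.congr_fun this c
    ext v : 2
    simp only [LinearMap.comp_apply, lsingle_apply, subdivision_of]
    refine boundary_cone _ ?_
    change boundary m _ = 0
    rw [ih, boundary_boundary, map_zero]

theorem boundary_homotopy {m : ℕ} {c : TupleChain S R m} (hc : IsCycle c) :
    boundary m (homotopy b m c) = c - subdivision b m c := by
  have key : ∀ m (c : TupleChain S R (m + 1)), boundary (m + 1) (homotopy b (m + 1) c) =
      c - subdivision b (m + 1) c - homotopy b m (boundary m c) := by
    intro m
    suffices boundary (m + 1) ∘ₗ homotopy b (m + 1) =
        (LinearMap.id : TupleChain S R (m + 1) →ₗ[R] _) - subdivision b (m + 1) -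
          homotopy b m ∘ₗ boundary m from fun c => LinearMap.congr_fun this c
    induction m with
    | zero =>
      ext v : 2
      simp only [LinearMap.comp_apply, lsingle_apply, LinearMap.sub_apply, LinearMap.id_apply,
        homotopy_of, boundary_cone_succ, subdivision_of]
      simp [homotopy, subdivision]
    | succ m ih =>
      ext v : 2
      have h := LinearMap.congr_fun ih (boundary (m + 1) (of R v))
      simp only [LinearMap.comp_apply, LinearMap.sub_apply, LinearMap.id_apply,
        boundary_boundary, map_zero,
        sub_zero] at h
      simp only [LinearMap.comp_apply, lsingle_apply, LinearMap.sub_apply, LinearMap.id_apply]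
      rw [homotopy_of, boundary_cone_succ, map_sub, h, subdivision_of, sub_sub_cancel,
        sub_right_comm]
  cases m with
  | zero => simp [homotopy, subdivision]
  | succ m => rw [key, show boundary m c = 0 from hc, map_zero, sub_zero]

theorem boundary_of_mem_supported {m : ℕ} {A : Set (Fin m → S)} {v : Fin (m + 1) → S}
    (h : ∀ p : Fin (m + 1), v ∘ p.succAbove ∈ A) : boundary m (of R v) ∈ supported R R A := by
  rw [boundary_of]
  exact sum_mem fun p _ => Submodule.smul_mem _ _ (single_mem_supported R _ (h p))

theorem cone_mem_supported {m : ℕ} {A : Set (Fin m → S)} {B : Set (Fin (m + 1) → S)} {x : S}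
    (h : ∀ v ∈ A, (Fin.cons x v : Fin (m + 1) → S) ∈ B) {c : TupleChain S R m}
    (hc : c ∈ supported R R A) : cone x m c ∈ supported R R B :=
  map_mem_supported _ (fun v hv => by
    rw [cone_of]; exact single_mem_supported R _ (h v hv)) hc

theorem push_mem_supported {m : ℕ} {A : Set (Fin m → S)} {B : Set (Fin m → S')} {g : S → S'}
    (h : ∀ v ∈ A, g ∘ v ∈ B) {c : TupleChain S R m}
    (hc : c ∈ supported R R A) : push g m c ∈ supported R R B :=
  map_mem_supported _ (fun v hv => by
    rw [push_of]; exact single_mem_supported R _ (h v hv)) hc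

/-- A set of points containing the centres of all tuples of its elements. -/
def CenterClosed (Q : Set S) : Prop := ∀ m (v : Fin (m + 1) → S), (∀ i, v i ∈ Q) → b m v ∈ Q

theorem cons_mem {Q : Set S} {x : S} (hx : x ∈ Q) {m : ℕ} {v : Fin m → S} (hv : ∀ i, v i ∈ Q)
    (i : Fin (m + 1)) : (Fin.cons x v : Fin (m + 1) → S) i ∈ Q := by
  cases i using Fin.cases with
  | zero => exact hx
  | succ i => exact hv i

variable {b} in
theorem subdivision_mem_supported {Q : Set S} (hQ : CenterClosed b Q) {m : ℕ}
    {c : TupleChain S R m} (hc : c ∈ supported R R {v | ∀ i, v i ∈ Q}) :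
    subdivision b m c ∈ supported R R {v | ∀ i, v i ∈ Q} := by
  induction m with
  | zero => exact hc
  | succ m ih =>
    refine map_mem_supported _ (fun v hv => ?_) hc
    rw [subdivision_of]
    refine cone_mem_supported (A := {w | ∀ i, w i ∈ Q}) (B := {w | ∀ i, w i ∈ Q})
      (fun w hw => cons_mem (hQ m v hv) hw) ?_
    exact (ih (boundary_of_mem_supported fun p i => hv _))

variable {b} in
theorem homotopy_mem_supported {Q : Set S} (hQ : CenterClosed b Q) {m : ℕ}
    {c : TupleChain S R m} (hc : c ∈ supported R R {v | ∀ i, v i ∈ Q}) :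
    homotopy b m c ∈ supported R R {v | ∀ i, v i ∈ Q} := by
  induction m with
  | zero => simp [homotopy]
  | succ m ih =>
    refine map_mem_supported _ (fun v hv => ?_) hc
    rw [homotopy_of]
    refine cone_mem_supported (A := {w | ∀ i, w i ∈ Q}) (B := {w | ∀ i, w i ∈ Q})
      (fun w hw => cons_mem (hQ m v hv) hw) ?_
    exact (sub_mem (single_mem_supported R _ hv) (ih (boundary_of_mem_supported fun p i => hv _)))

end TupleChain

namespace stdSimplex

/-- The affine map of standard simplices with prescribed images of the vertices. -/
def affine {m n : ℕ} (v : Fin m → stdSimplex ℝ (Fin n)) :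
    C(stdSimplex ℝ (Fin m), stdSimplex ℝ (Fin n)) where
  toFun t := ⟨fun j => ∑ i, t i * v i j,
    fun j => Finset.sum_nonneg fun i _ => mul_nonneg (t.2.1 i) ((v i).2.1 j), by
      rw [Finset.sum_comm]
      simp [← Finset.mul_sum]⟩
  continuous_toFun := by
    refine Continuous.subtype_mk (continuous_pi fun j => continuous_finsetSum _ fun i _ => ?_) _
    exact ((continuous_apply i).comp continuous_subtype_val).mul continuous_const

variable {l m n : ℕ}

theorem affine_apply (v : Fin m → stdSimplex ℝ (Fin n)) (t : stdSimplex ℝ (Fin m)) (j : Fin n) :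
    affine v t j = ∑ i, t i * v i j := rfl

theorem affine_vertex (v : Fin m → stdSimplex ℝ (Fin n)) (i : Fin m) :
    affine v (vertex i) = v i := by
  ext j
  simp [affine_apply, Pi.single_apply]

theorem affine_comp (w : Fin m → stdSimplex ℝ (Fin n)) (v : Fin l → stdSimplex ℝ (Fin m)) :
    (affine w).comp (affine v) = affine (affine w ∘ v) := by
  ext t j
  simp only [ContinuousMap.comp_apply, affine_apply, Function.comp_apply, Finset.sum_mul,
    Finset.mul_sum]
  rw [Finset.sum_comm]
  simp only [mul_assoc]

theorem affMap_eq_affine (u : Fin m → Fin n) : affMap u = affine (vertex ∘ u) := by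
  ext t j
  change (∑ i, if u i = j then t.1 i else 0) = _
  rw [affine_apply]
  refine Finset.sum_congr rfl fun i _ => ?_
  by_cases h : u i = j
  · subst h; simp; rfl
  · simp [h, Ne.symm h]

theorem affine_vertices : affine vertex = ContinuousMap.id (stdSimplex ℝ (Fin n)) := by
  ext t j
  simp [affine_apply, Pi.single_apply]

theorem affMap_vertex (u : Fin m → Fin n) : affMap u ∘ vertex = vertex ∘ u := by
  ext1 i
  rw [affMap_eq_affine, Function.comp_apply, affine_vertex]

theorem affMap_comp_affine (u : Fin m → Fin n) (v : Fin l → stdSimplex ℝ (Fin m)) :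
    (affMap u).comp (affine v) = affine (affMap u ∘ v) := by
  rw [affMap_eq_affine, affine_comp]

theorem affine_comp_affMap (v : Fin m → stdSimplex ℝ (Fin n)) (u : Fin l → Fin m) :
    (affine v).comp (affMap u) = affine (v ∘ u) := by
  rw [affMap_eq_affine, affine_comp]
  congr 1
  ext1 i
  simp only [Function.comp_apply, affine_vertex]

theorem affMap_comp_affMap (v : Fin m → Fin n) (u : Fin l → Fin m) :
    (affMap v).comp (affMap u) = affMap (v ∘ u) := by
  rw [affMap_eq_affine v, affine_comp_affMap, affMap_eq_affine, Function.comp_assoc]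

/-- Subsets of a simplex containing all affine simplices spanned by their points. -/
def AffinelyClosed (Q : Set (stdSimplex ℝ (Fin n))) : Prop :=
  ∀ (m : ℕ) (v : Fin m → stdSimplex ℝ (Fin n)), (∀ i, v i ∈ Q) → ∀ t, affine v t ∈ Q

theorem affinelyClosed_range (v : Fin m → stdSimplex ℝ (Fin n)) :
    AffinelyClosed (range (affine v)) := by
  intro k w hw t
  choose s hs using hw
  obtain rfl : affine v ∘ s = w := funext hs
  exact ⟨affine s t, by rw [← affine_comp]; rfl⟩

theorem dist_affine_le (v : Fin m → stdSimplex ℝ (Fin n)) (t : stdSimplex ℝ (Fin m))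
    (y : stdSimplex ℝ (Fin n)) : dist (affine v t) y ≤ ∑ i, t i * dist (v i) y := by
  refine (dist_pi_le_iff (Finset.sum_nonneg fun i _ => mul_nonneg (t.2.1 i) dist_nonneg)).2
    fun j => ?_
  have h : affine v t j - y j = ∑ i, t i * (v i j - y j) := by
    simp [affine_apply, mul_sub, ← Finset.sum_mul]
  change |affine v t j - y j| ≤ _
  rw [h]
  refine (Finset.abs_sum_le_sum_abs _ _).trans (Finset.sum_le_sum fun i _ => ?_)
  rw [abs_mul, abs_of_nonneg (stdSimplex.zero_le t i)]
  exact mul_le_mul_of_nonneg_left (dist_le_pi_dist (v i).1 y.1 j) (t.2.1 i)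

theorem affinelyClosed_closedBall (y : stdSimplex ℝ (Fin n)) (r : ℝ) :
    AffinelyClosed (Metric.closedBall y r) := by
  intro m v hv t
  calc dist (affine v t) y ≤ ∑ i, t i * dist (v i) y := dist_affine_le v t y
    _ ≤ ∑ i, t i * r := Finset.sum_le_sum fun i _ => mul_le_mul_of_nonneg_left (hv i) (t.2.1 i)
    _ = r := by rw [← Finset.sum_mul, sum_eq_one, one_mul]

/-- The barycentre of the affine simplex spanned by a nonempty tuple of points. -/
def center (m : ℕ) (v : Fin (m + 1) → stdSimplex ℝ (Fin n)) : stdSimplex ℝ (Fin n) :=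
  affine v barycenter

theorem AffinelyClosed.centerClosed {Q : Set (stdSimplex ℝ (Fin n))} (hQ : AffinelyClosed Q) :
    TupleChain.CenterClosed center Q :=
  fun m v hv => hQ (m + 1) v hv _

/-- The tuples of points at pairwise distance at most `δ`. -/
def meshLE (n m : ℕ) (δ : ℝ) : Set (Fin m → stdSimplex ℝ (Fin n)) :=
  {v | ∀ i j, dist (v i) (v j) ≤ δ}

theorem dist_center_le {N : ℕ} (hm : m ≤ N) {δ : ℝ} {v : Fin (m + 1) → stdSimplex ℝ (Fin n)}
    (hv : v ∈ meshLE n (m + 1) δ) (i : Fin (m + 1)) :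
    dist (v i) (center m v) ≤ (1 - 1 / (N + 1)) * δ := by
  have hδ : 0 ≤ δ := dist_nonneg.trans (hv 0 0)
  have hmN : (1 : ℝ) / (N + 1) ≤ 1 / (m + 1) :=
    one_div_le_one_div_of_le (by positivity) (by exact_mod_cast Nat.succ_le_succ hm)
  rw [dist_comm]
  refine (dist_affine_le v barycenter (v i)).trans ?_
  have hb : ∀ l : Fin (m + 1), (barycenter : stdSimplex ℝ (Fin (m + 1))) l = 1 / (m + 1) :=
    fun l => (barycenter_apply l).trans (by simp)
  calc ∑ l, (barycenter : stdSimplex ℝ (Fin (m + 1))) l * dist (v l) (v i)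
      ≤ ∑ l, 1 / ((m : ℝ) + 1) * (if l = i then 0 else δ) := by
        refine Finset.sum_le_sum fun l _ => ?_
        rw [hb]
        refine mul_le_mul_of_nonneg_left ?_ (by positivity)
        split_ifs with h
        · rw [h, dist_self]
        · exact hv l i
    _ = (1 - 1 / (m + 1)) * δ := by
        rw [← Finset.mul_sum, Finset.sum_ite, Finset.sum_const_zero, Finset.sum_const,
          Finset.filter_ne']
        simp
        field_simp
        simp [mul_comm]
    _ ≤ (1 - 1 / (N + 1)) * δ := by gcongr

open TupleChain Finsupp

variable {R : Type*} [CommRing R]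

theorem subdivision_mem_supported_range (v : Fin m → stdSimplex ℝ (Fin n)) :
    subdivision center m (of R v) ∈ supported R R {w | ∀ i, w i ∈ range (affine v)} :=
  subdivision_mem_supported (affinelyClosed_range v).centerClosed
    (single_mem_supported R _ fun i => ⟨_, affine_vertex v i⟩)

theorem homotopy_mem_supported_range (v : Fin m → stdSimplex ℝ (Fin n)) :
    homotopy center m (of R v) ∈ supported R R {w | ∀ i, w i ∈ range (affine v)} :=
  homotopy_mem_supported (affinelyClosed_range v).centerClosed
    (single_mem_supported R _ fun i => ⟨_, affine_vertex v i⟩)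

theorem subdivision_mem_supported_meshLE {N : ℕ} (hm : m ≤ N + 1) {δ : ℝ}
    {c : TupleChain (stdSimplex ℝ (Fin n)) R m} (hc : c ∈ supported R R (meshLE n m δ)) :
    subdivision center m c ∈ supported R R (meshLE n m ((1 - 1 / (N + 1)) * δ)) := by
  induction m with
  | zero => exact supported_mono (fun v _ i => i.elim0) hc
  | succ m ih =>
    refine map_mem_supported _ (fun v hv => ?_) hc
    have hr : 0 ≤ (1 - 1 / ((N : ℝ) + 1)) * δ :=
      dist_nonneg.trans (dist_center_le (Nat.le_of_succ_le_succ hm) hv 0)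
    have h1 : subdivision center m (boundary m (of R v)) ∈
        supported R R (meshLE n m ((1 - 1 / (N + 1)) * δ)) :=
      ih (by omega) (boundary_of_mem_supported fun p i j => hv _ _)
    have h2 : subdivision center m (boundary m (of R v)) ∈ supported R R
        {w | ∀ i, w i ∈ Metric.closedBall (center m v) ((1 - 1 / (N + 1)) * δ)} :=
      subdivision_mem_supported (affinelyClosed_closedBall _ _).centerClosed
        (boundary_of_mem_supported fun p i => dist_center_le (Nat.le_of_succ_le_succ hm) hv _)
    rw [subdivision_of]
    refine cone_mem_supported (fun w hw i j => ?_)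
      ((supported_inter (M := R) (R := R) _ _).ge ⟨h1, h2⟩)
    cases i using Fin.cases with
    | zero =>
      cases j using Fin.cases with
      | zero => simpa using hr
      | succ j => simpa [dist_comm] using hw.2 j
    | succ i =>
      cases j using Fin.cases with
      | zero => simpa using hw.2 i
      | succ j => simpa using hw.1 i j

/-- The tuples spanning an affine simplex contained in some member of `𝒱`. -/
def spanIn (m : ℕ) (𝒱 : Set (Set (stdSimplex ℝ (Fin n)))) : Set (Fin m → stdSimplex ℝ (Fin n)) :=
  {v | ∃ V ∈ 𝒱, range (affine v) ⊆ V}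

theorem subset_spanIn_of_mem {𝒱 : Set (Set (stdSimplex ℝ (Fin n)))}
    {v : Fin l → stdSimplex ℝ (Fin n)} (hv : v ∈ spanIn l 𝒱) :
    {w : Fin m → stdSimplex ℝ (Fin n) | ∀ i, w i ∈ range (affine v)} ⊆ spanIn m 𝒱 := by
  obtain ⟨V, hV, h⟩ := hv
  exact fun w hw => ⟨V, hV,
    (range_subset_iff.2 (affinelyClosed_range v m w hw)).trans h⟩

theorem exists_meshLE_subset_spanIn {𝒱 : Set (Set (stdSimplex ℝ (Fin n)))}
    (h𝒱 : ∀ x, ∃ V ∈ 𝒱, V ∈ nhds x) :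
    ∃ ε > 0, ∀ δ < ε, ∀ m, meshLE n (m + 1) δ ⊆ spanIn (m + 1) 𝒱 := by
  choose V hV hx using h𝒱
  obtain ⟨ε, hε, h⟩ := lebesgue_number_lemma_of_metric (c := fun x => interior (V x))
    isCompact_univ (fun _ => isOpen_interior)
    (fun x _ => mem_iUnion.2 ⟨x, mem_interior_iff_mem_nhds.2 (hx x)⟩)
  refine ⟨ε, hε, fun δ hδ m v hv => ?_⟩
  obtain ⟨x, hx⟩ := h (v 0) (mem_univ _)
  refine ⟨V x, hV x, range_subset_iff.2 fun t => interior_subset (hx ?_)⟩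
  exact Metric.closedBall_subset_ball hδ (affinelyClosed_closedBall (v 0) δ _ v (fun i => hv i 0) t)

/-- Cycles of small affine simplices bound chains of small affine simplices. -/
theorem exists_boundary_eq {𝒱 : Set (Set (stdSimplex ℝ (Fin n)))}
    (h𝒱 : ∀ x, ∃ V ∈ 𝒱, V ∈ nhds x) [Nonempty (stdSimplex ℝ (Fin n))]
    {z : TupleChain (stdSimplex ℝ (Fin n)) R m} (hz : IsCycle z)
    (hzs : z ∈ supported R R (spanIn m 𝒱)) :
    ∃ c ∈ supported R R (spanIn (m + 1) 𝒱), boundary m c = z := by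
  obtain ⟨ε, hε, hmesh⟩ := exists_meshLE_subset_spanIn h𝒱
  set r : ℝ := 1 - 1 / (m + 1) with hr
  have hr0 : 0 ≤ r := sub_nonneg.2 ((div_le_one (by positivity)).2 (by simp))
  have hr1 : r < 1 := sub_lt_self _ (by positivity)
  have key : ∀ k : ℕ, ∃ c ∈ supported R R (spanIn (m + 1) 𝒱 ∪
      meshLE n (m + 1) (r ^ k * Metric.diam (univ : Set (stdSimplex ℝ (Fin n))))),
      boundary m c = z := by
    intro k
    induction k with
    | zero =>
      refine ⟨cone (Classical.arbitrary _) m z, ?_, boundary_cone _ hz⟩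
      refine fun v _ => Or.inr fun i j => ?_
      rw [pow_zero, one_mul]
      exact Metric.dist_le_diam_of_mem isCompact_univ.isBounded (mem_univ _) (mem_univ _)
    | succ k ih =>
      obtain ⟨c, hc, rfl⟩ := ih
      refine ⟨subdivision center (m + 1) c + homotopy center m (boundary m c), add_mem ?_ ?_, ?_⟩
      · refine map_mem_supported _ (fun v hv => ?_) hc
        rcases hv with hv | hv
        · exact supported_mono ((subset_spanIn_of_mem hv).trans subset_union_left)
            (subdivision_mem_supported_range v)
        · rw [pow_succ', mul_assoc]
          exact supported_mono subset_union_right (subdivision_mem_supported_meshLE le_rfl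
            (single_mem_supported R _ hv))
      · refine map_mem_supported _ (fun v hv => ?_) hzs
        exact supported_mono ((subset_spanIn_of_mem hv).trans subset_union_left)
            (homotopy_mem_supported_range v)
      · rw [map_add, boundary_subdivision, boundary_homotopy _ hz, add_sub_cancel]
  have hlim : Filter.Tendsto
      (fun k : ℕ => r ^ k * Metric.diam (univ : Set (stdSimplex ℝ (Fin n)))) Filter.atTop
      (nhds 0) := by
    simpa using (tendsto_pow_atTop_nhds_zero_of_lt_one hr0 hr1).mul_const _
  obtain ⟨k, hk⟩ := (hlim.eventually (gt_mem_nhds hε)).exists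
  obtain ⟨c, hc, h⟩ := key k
  exact ⟨c, supported_mono (union_subset Subset.rfl (hmesh _ hk m)) hc, h⟩

end stdSimplex

section PreChainMap

open TupleChain stdSimplex Finsupp

variable {X R : Type*} [TopologicalSpace X] [CommRing R]

/-- The alternating sum over the faces of `σ` of the pushed forward values of `ℓ`. -/
def faceSum {m : ℕ} (ℓ : C(stdSimplex ℝ (Fin m), X) → TupleChain (stdSimplex ℝ (Fin m)) R m)
    (σ : C(stdSimplex ℝ (Fin (m + 1)), X)) : TupleChain (stdSimplex ℝ (Fin (m + 1))) R m :=
  ∑ p : Fin (m + 1),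
    (-1 : R) ^ (p : ℕ) • push (affMap p.succAbove) m (ℓ (σ.comp (affMap p.succAbove)))

theorem isCycle_faceSum {m : ℕ}
    {ℓ : C(stdSimplex ℝ (Fin m), X) → TupleChain (stdSimplex ℝ (Fin m)) R m}
    {ℓ' : C(stdSimplex ℝ (Fin (m + 1)), X) → TupleChain (stdSimplex ℝ (Fin (m + 1))) R (m + 1)}
    (h : ∀ σ, boundary m (ℓ' σ) = faceSum ℓ σ) (σ : C(stdSimplex ℝ (Fin (m + 2)), X)) :
    IsCycle (faceSum ℓ' σ) := by
  let F : TupleChain (Fin (m + 2)) R m →ₗ[R] TupleChain (stdSimplex ℝ (Fin (m + 2))) R m :=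
    linearCombination R fun u => push (affMap u) m (ℓ (σ.comp (affMap u)))
  have hF : ∀ u : Fin (m + 1) → Fin (m + 2),
      boundary m (push (affMap u) (m + 1) (ℓ' (σ.comp (affMap u)))) = F (boundary m (of R u)) := by
    intro u
    rw [boundary_push, h, faceSum, boundary_of, map_sum, map_sum]
    refine Finset.sum_congr rfl fun p _ => ?_
    rw [map_smul, map_smul, push_push, ContinuousMap.comp_assoc, ← ContinuousMap.coe_comp,
      affMap_comp_affMap, linearCombination_single, one_smul]
  change boundary m _ = 0
  have hid : ∑ p : Fin (m + 2), (-1 : R) ^ (p : ℕ) • of R p.succAbove =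
      boundary (m + 1) (of R id) := by
    simp only [boundary_of, Function.id_comp]
  simp only [faceSum, map_sum, map_smul, hF]
  simp only [← map_smul, ← map_sum, hid, boundary_boundary, map_zero]

/-- The properties of a single level of a small subdivision that allow it to be extended to the
next level. -/
structure IsSmallSubdivision (𝒜 : Set (Set X)) (W : Set X) {m : ℕ}
    (ℓ : C(stdSimplex ℝ (Fin m), X) → TupleChain (stdSimplex ℝ (Fin m)) R m) : Prop where
  isCycle : ∀ σ, IsCycle (faceSum ℓ σ)
  mem_supported : ∀ σ : C(stdSimplex ℝ (Fin m), X), range σ ⊆ W →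
    ℓ σ ∈ supported R R {v | ∃ U ∈ 𝒜, range (σ ∘ affine v) ⊆ U}
  eq_of : ∀ (σ : C(stdSimplex ℝ (Fin m), X)), ∀ U ∈ 𝒜, range σ ⊆ U → ℓ σ = of R vertex

variable {𝒜 : Set (Set X)} {W : Set X}

theorem IsSmallSubdivision.zero (h𝒜 : ∅ ∈ 𝒜) :
    IsSmallSubdivision 𝒜 W fun _ : C(stdSimplex ℝ (Fin 0), X) => of R vertex where
  isCycle _ := trivial
  mem_supported σ _ := single_mem_supported R _ ⟨∅, h𝒜, by
    rintro _ ⟨t, -⟩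
    simpa using stdSimplex.sum_eq_one t⟩
  eq_of _ _ _ _ := rfl

theorem IsSmallSubdivision.exists_boundary_eq_faceSum
    (hcov : ∀ x ∈ W, ∃ U ∈ 𝒜, U ∈ nhdsWithin x W)
    {m : ℕ} {ℓ : C(stdSimplex ℝ (Fin m), X) → TupleChain (stdSimplex ℝ (Fin m)) R m}
    (hℓ : IsSmallSubdivision 𝒜 W ℓ) (σ : C(stdSimplex ℝ (Fin (m + 1)), X)) :
    ∃ c : TupleChain (stdSimplex ℝ (Fin (m + 1))) R (m + 1), boundary m c = faceSum ℓ σ ∧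
      (range σ ⊆ W → c ∈ supported R R {v | ∃ U ∈ 𝒜, range (σ ∘ affine v) ⊆ U}) ∧
      (∀ U ∈ 𝒜, range σ ⊆ U → c = of R vertex) := by
  by_cases hU : ∃ U ∈ 𝒜, range σ ⊆ U
  · obtain ⟨U, hU, hσ⟩ := hU
    refine ⟨of R vertex, ?_, fun _ => ?_, fun _ _ _ => rfl⟩
    · rw [boundary_of, faceSum]
      refine Finset.sum_congr rfl fun p _ => ?_
      rw [hℓ.eq_of _ U hU ((range_comp_subset_range (affMap p.succAbove) σ).trans hσ),
        push_of, affMap_vertex]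
    · exact single_mem_supported R _ ⟨U, hU, (range_comp_subset_range _ _).trans hσ⟩
  · let 𝒱 : Set (Set (stdSimplex ℝ (Fin (m + 1)))) := {V | range σ ⊆ W → ∃ U ∈ 𝒜, σ '' V ⊆ U}
    have h𝒱 : ∀ x, ∃ V ∈ 𝒱, V ∈ nhds x := by
      intro x
      by_cases hW : range σ ⊆ W
      · obtain ⟨U, hU, hx⟩ := hcov (σ x) (hW ⟨x, rfl⟩)
        refine ⟨σ ⁻¹' U, fun _ => ⟨U, hU, image_preimage_subset _ _⟩, ?_⟩
        exact (tendsto_nhdsWithin_iff.2 ⟨σ.continuous.continuousAt,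
          Filter.Eventually.of_forall fun y => hW ⟨y, rfl⟩⟩) hx
      · exact ⟨univ, fun h => absurd h hW, Filter.univ_mem⟩
    have hz : faceSum ℓ σ ∈ supported R R (spanIn m 𝒱) := by
      refine sum_mem fun p _ => Submodule.smul_mem _ _ ?_
      by_cases hW : range σ ⊆ W
      · refine push_mem_supported (fun v hv => ?_)
          (hℓ.mem_supported _ ((range_comp_subset_range (affMap p.succAbove) σ).trans hW))
        obtain ⟨U, hU, h⟩ := hv
        refine ⟨_, fun _ => ⟨U, hU, ?_⟩, Subset.rfl⟩
        rwa [← range_comp, ← affMap_comp_affine]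
      · exact fun v _ => ⟨univ, fun h => absurd h hW, subset_univ _⟩
    obtain ⟨c, hc, h⟩ := exists_boundary_eq h𝒱 (hℓ.isCycle σ) hz
    refine ⟨c, h, fun hW => supported_mono ?_ hc, fun U hU' h' => absurd ⟨U, hU', h'⟩ hU⟩
    rintro v ⟨V, hV, hv⟩
    obtain ⟨U, hU, h⟩ := hV hW
    exact ⟨U, hU, by rw [range_comp]; exact (image_mono hv).trans h⟩

theorem IsSmallSubdivision.exists_succ (hcov : ∀ x ∈ W, ∃ U ∈ 𝒜, U ∈ nhdsWithin x W)
    {m : ℕ} {ℓ : C(stdSimplex ℝ (Fin m), X) → TupleChain (stdSimplex ℝ (Fin m)) R m}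
    (hℓ : IsSmallSubdivision 𝒜 W ℓ) :
    ∃ ℓ' : C(stdSimplex ℝ (Fin (m + 1)), X) → TupleChain (stdSimplex ℝ (Fin (m + 1))) R (m + 1),
      IsSmallSubdivision 𝒜 W ℓ' ∧ ∀ σ, boundary m (ℓ' σ) = faceSum ℓ σ := by
  choose ℓ' h using hℓ.exists_boundary_eq_faceSum hcov
  exact ⟨ℓ', ⟨isCycle_faceSum fun σ => (h σ).1, fun σ => (h σ).2.1, fun σ => (h σ).2.2⟩,
    fun σ => (h σ).1⟩

theorem exists_smallSubdivision (h𝒜 : ∅ ∈ 𝒜) (hcov : ∀ x ∈ W, ∃ U ∈ 𝒜, U ∈ nhdsWithin x W) :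
    ∃ ℓ : ∀ m, C(stdSimplex ℝ (Fin m), X) → TupleChain (stdSimplex ℝ (Fin m)) R m,
      (∀ m, IsSmallSubdivision 𝒜 W (ℓ m)) ∧
        ∀ m σ, boundary m (ℓ (m + 1) σ) = faceSum (ℓ m) σ := by
  choose next hnext using fun (m : ℕ)
    (ℓ : {ℓ : C(stdSimplex ℝ (Fin m), X) → TupleChain (stdSimplex ℝ (Fin m)) R m //
      IsSmallSubdivision 𝒜 W ℓ}) => ℓ.2.exists_succ hcov
  let L : ∀ m, {ℓ : C(stdSimplex ℝ (Fin m), X) → TupleChain (stdSimplex ℝ (Fin m)) R m //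
      IsSmallSubdivision 𝒜 W ℓ} := fun m =>
    Nat.rec ⟨_, IsSmallSubdivision.zero h𝒜⟩ (fun m ℓ => ⟨next m ℓ, (hnext m ℓ).1⟩) m
  exact ⟨fun m => (L m).1, fun m => (L m).2, fun m => (hnext m (L m)).2⟩

/-- The singular chain of affine simplices determined by a tuple chain in a simplex. -/
def realize {k n : ℕ} (c : TupleChain (Δ n) R (k + 1)) : FChain (Δ n) R k :=
  mapDomain affine c

theorem fboundary_realize {k n : ℕ} (c : TupleChain (Δ n) R (k + 2)) :
    fboundary k (realize c) = realize (boundary (k + 1) c) := by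
  rw [fboundary, realize, sum_mapDomain_index (by simp) (by simp [mul_add, Finset.sum_add_distrib]),
    boundary, linearCombination_apply, realize, Finsupp.sum, Finsupp.sum, mapDomain_finsetSum]
  refine Finset.sum_congr rfl fun v _ => ?_
  rw [mapDomain_smul, mapDomain_finsetSum, Finset.smul_sum]
  refine Finset.sum_congr rfl fun p _ => ?_
  rw [mapDomain_smul, mapDomain_single, face, affine_comp_affMap, smul_single, smul_single]
  simp [mul_comm]

theorem fpush_face_realize {k : ℕ} (p : Fin (k + 2)) (c : TupleChain (Δ k) R (k + 1)) :
    fpush (face k p) (realize c) = realize (push (affMap p.succAbove) (k + 1) c) := by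
  rw [fpush, realize, realize, push, lmapDomain_apply, ← mapDomain_comp, ← mapDomain_comp]
  congr 1
  funext v
  exact affMap_comp_affine _ v

theorem realize_faceSum {k : ℕ}
    (ℓ : C(Δ k, X) → TupleChain (Δ k) R (k + 1)) (σ : C(Δ (k + 1), X)) :
    realize (faceSum ℓ σ) =
      ∑ p : Fin (k + 2),
        (-1 : R) ^ (p : ℕ) • fpush (face k p) (realize (ℓ (σ.comp (face k p)))) := by
  rw [faceSum, realize, mapDomain_finsetSum]
  refine Finset.sum_congr rfl fun p _ => ?_
  rw [mapDomain_smul, fpush_face_realize]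
  rfl

end PreChainMap

theorem exists_subdivision_preChainMap
    {X : Type*} [TopologicalSpace X] (R : Type*) [CommRing R]
    (𝒜 : Set (Set X)) (W : Set X) (hW : ⋃₀ 𝒜 = W)
    (hcov : (⋃ U ∈ 𝒜, interior ((Subtype.val ⁻¹' U : Set W))) = Set.univ) :
    ∃ hb : ∀ k : ℕ, SSimplex X k → FChain (Δ k) R k,
      IsPreChainMap hb ∧
      (∀ (k : ℕ) (σ : SSimplex X k), Set.range ⇑σ ⊆ W →
        ∀ η ∈ (hb k σ).support, ∃ U ∈ 𝒜, Set.range (⇑σ ∘ ⇑η) ⊆ U) ∧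
      (∀ (k : ℕ) (σ : SSimplex X k) (U : Set X), U ∈ 𝒜 → Set.range ⇑σ ⊆ U →
        hb k σ = Finsupp.single (ContinuousMap.id (Δ k)) 1) := by
  obtain ⟨ℓ, hℓ, hbd⟩ := exists_smallSubdivision (R := R) (𝒜 := insert ∅ 𝒜) (W := W)
    (mem_insert _ _) fun x hx => by
      have : (⟨x, hx⟩ : W) ∈ ⋃ U ∈ 𝒜, interior ((Subtype.val ⁻¹' U : Set W)) := hcov ▸ mem_univ _
      obtain ⟨U, hU, h⟩ := mem_iUnion₂.1 this
      exact ⟨U, mem_insert_of_mem _ hU,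
        preimage_coe_mem_nhds_subtype.1 (mem_interior_iff_mem_nhds.1 h)⟩
  refine ⟨fun k σ => realize (ℓ (k + 1) σ), fun k σ => ?_, fun k σ hσ η hη => ?_,
    fun k σ U hU hσ => ?_⟩
  · rw [fboundary_realize, hbd, realize_faceSum]
  · obtain ⟨v, hv, rfl⟩ := Finset.mem_image.1 (Finsupp.mapDomain_support hη)
    obtain ⟨U, hU, h⟩ := (hℓ (k + 1)).mem_supported σ hσ hv
    refine ⟨U, hU.resolve_left ?_, h⟩
    rintro rfl
    exact (range_nonempty _).not_subset_empty h
  · simp only [(hℓ (k + 1)).eq_of σ U (mem_insert_of_mem _ hU) hσ, realize,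
      Finsupp.mapDomain_single, stdSimplex.affine_vertices]

end
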